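/- Let M be a definite multi-context system with grounded equilibrium S, let C_i be a context, and let M_U be the fragment of M whose bridge rules are the union R̄(C_i) of the bridge-rule sets of all supports of C_i in M, with grounded equilibrium S_U. Then for every query literal p, p ∈ S_i if and only if p ∈ (S_U)_i; in particular (S_U)_i = S_i. -/

import Mathlib

/-- A bridge rule of a definite MCS: a head literal and a finite positive body. -/
structure Rule (n : ℕ) (α : Type*) where
  head : α
  body : Finset (Fin n × α)
deriving DecidableEq

/-- A definite multi-context system: for each context, a monotone semantic
operator and a finite set of bridge rules. -/
structure MCS (n : ℕ) (α : Type*) [DecidableEq α] where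
  ACC : Fin n → Finset α → Finset α
  mono : ∀ i, Monotone (ACC i)
  br : Fin n → Finset (Rule n α)

variable {n : ℕ} {α : Type*} [DecidableEq α]

/-- A bridge rule is satisfied in a belief state `S` iff every body literal holds. -/
def Satisfied (r : Rule n α) (S : Fin n → Finset α) : Prop :=
  ∀ cp ∈ r.body, cp.2 ∈ S cp.1

instance (r : Rule n α) (S : Fin n → Finset α) : Decidable (Satisfied r S) := by
  unfold Satisfied; infer_instance

/-- The knowledge base induced at context `i` by belief state `S`:
the heads of the bridge rules of context `i` satisfied in `S`. -/
def kbOf (M : MCS n α) (S : Fin n → Finset α) (i : Fin n) : Finset α :=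
  ((M.br i).filter (fun r => Satisfied r S)).image Rule.head

/-- A belief state is an equilibrium iff each belief set is the result of
applying the semantic operator to the induced knowledge base. -/
def IsEquilibrium (M : MCS n α) (S : Fin n → Finset α) : Prop :=
  ∀ i, S i = M.ACC i (kbOf M S i)

/-- The grounded equilibrium: the pointwise-⊆-least equilibrium. -/
def IsGrounded (M : MCS n α) (S : Fin n → Finset α) : Prop :=
  IsEquilibrium M S ∧ ∀ E, IsEquilibrium M E → ∀ i, S i ⊆ E i

/-- `M'` is a fragment of `M`: same contexts and operators, fewer bridge rules. -/
def Fragment (M' M : MCS n α) : Prop :=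
  M'.ACC = M.ACC ∧ ∀ i, M'.br i ⊆ M.br i

/-- The input signature of context `i`: the heads of its bridge rules. -/
def sig (M : MCS n α) (i : Fin n) : Finset α :=
  (M.br i).image Rule.head

/-- `In` is an immediate rule support of context `i`: a subset of `br i` containing,
for every literal of the input signature of `i`, a rule with that head. -/
def ImmRuleSupport (M : MCS n α) (i : Fin n) (In : Finset (Rule n α)) : Prop :=
  In ⊆ M.br i ∧ ∀ p ∈ sig M i, ∃ r ∈ In, r.head = p

/-- The (recursive) defining conditions of a support of context `i`, read
coinductively: there is a family `F` of (bridge-rule tuple, context) pairs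
containing `(br', i)` such that every member `(b, j)` of `F` is a fragment of `M`
containing an immediate rule support of `j`, and for every body literal `(c, p)` of
every rule of `b`, `b` contains a member of `F` supporting `c`. -/
def SupportPre (M : MCS n α) (br' : Fin n → Finset (Rule n α)) (i : Fin n) : Prop :=
  ∃ F : Set ((Fin n → Finset (Rule n α)) × Fin n),
    (br', i) ∈ F ∧
    ∀ q ∈ F,
      (∀ j, q.1 j ⊆ M.br j) ∧
      (∃ In, ImmRuleSupport M q.2 In ∧ In ⊆ q.1 q.2) ∧
      ∀ j, ∀ r ∈ q.1 j, ∀ cp ∈ r.body,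
        ∃ b : Fin n → Finset (Rule n α), (∀ k, b k ⊆ q.1 k) ∧ (b, cp.1) ∈ F

/-- `br'` is a support of context `i` in `M`: it satisfies the support conditions
and its bridge-rule sets are ⊆-minimal (componentwise) subject to them. -/
def IsSupport (M : MCS n α) (br' : Fin n → Finset (Rule n α)) (i : Fin n) : Prop :=
  SupportPre M br' i ∧
  ∀ b : Fin n → Finset (Rule n α),
    (∀ j, b j ⊆ br' j) → b ≠ br' → ¬ SupportPre M b i

/-- The applications of the semantic operators to the knowledge bases induced by `X`. -/
def consequence (M : MCS n α) (X : Fin n → Finset α) (j : Fin n) : Finset α :=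
  M.ACC j (kbOf M X j)

theorem mem_kbOf {M : MCS n α} {X : Fin n → Finset α} {j : Fin n} {p : α} :
    p ∈ kbOf M X j ↔ ∃ r ∈ M.br j, Satisfied r X ∧ r.head = p := by
  simp [kbOf, and_assoc]

omit [DecidableEq α] in
theorem Satisfied.mono {r : Rule n α} {X Y : Fin n → Finset α} (h : Satisfied r X)
    (hXY : ∀ cp ∈ r.body, X cp.1 ⊆ Y cp.1) : Satisfied r Y :=
  fun cp hcp => hXY cp hcp (h cp hcp)

theorem consequence_mono (M : MCS n α) : Monotone (consequence M) := by
  intro X Y hXY j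
  refine M.mono j fun p hp => ?_
  obtain ⟨r, hr, hs, rfl⟩ := mem_kbOf.1 hp
  exact mem_kbOf.2 ⟨r, hr, hs.mono fun cp _ => hXY cp.1, rfl⟩

/-- The grounded equilibrium lies below every belief state closed under consequence. -/
theorem IsGrounded.le_of_consequence_le {M : MCS n α} {S X : Fin n → Finset α}
    (hS : IsGrounded M S) (hX : consequence M X ≤ X) : S ≤ X := by
  obtain ⟨Y, hY⟩ := exists_minimal_of_wellFoundedLT
    (fun Y => consequence M Y ≤ Y ∧ Y ≤ X) ⟨X, hX, le_rfl⟩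
  have hYc : Y ≤ consequence M Y :=
    hY.2 ⟨consequence_mono M hY.1.1, hY.1.1.trans hY.1.2⟩ hY.1.1
  have hE : IsEquilibrium M Y := fun j => (hYc j).antisymm (hY.1.1 j)
  exact fun j => (hS.2 Y hE j).trans (hY.1.2 j)

/-- Context `j` has, among the rules `B`, a rule whose body mentions context `k`. -/
def Mentions (B : Fin n → Finset (Rule n α)) (j k : Fin n) : Prop :=
  ∃ r ∈ B j, ∃ cp ∈ r.body, cp.1 = k

/-- Context `j` can be reached from `i` by following the rules `B`. -/
abbrev Reaches (B : Fin n → Finset (Rule n α)) : Fin n → Fin n → Prop :=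
  Relation.ReflTransGen (Mentions B)

/-- Each `A j` selects exactly one rule of context `j` for each literal of its signature. -/
def IsTransversal (M : MCS n α) (A : Fin n → Finset (Rule n α)) : Prop :=
  ∀ j, A j ⊆ M.br j ∧ (∀ p ∈ sig M j, ∃ r ∈ A j, r.head = p) ∧
    Set.InjOn Rule.head (A j : Set (Rule n α))

theorem exists_isTransversal (M : MCS n α) : ∃ A, IsTransversal M A := by
  have h (j : Fin n) : ∃ B ⊆ M.br j, (∀ p ∈ sig M j, ∃ r ∈ B, r.head = p) ∧
      Set.InjOn Rule.head (B : Set (Rule n α)) := by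
    obtain ⟨B, hB, hinj, himg⟩ :=
      Finset.exists_subset_injOn_image_eq_of_surjOn (f := Rule.head)
        (M.br j : Set (Rule n α)) (sig M j) (by intro p hp; simpa [sig] using hp)
    refine ⟨B, by simpa using hB, fun p hp => ?_, hinj⟩
    rw [← himg] at hp
    exact Finset.mem_image.1 hp
  choose A hA using h
  exact ⟨A, hA⟩

/-- Modify `A` so that at context `j` it uses `r` for the head of `r`. -/
def selectRule (A : Fin n → Finset (Rule n α)) (j : Fin n) (r : Rule n α) :
    Fin n → Finset (Rule n α) :=
  Function.update A j (insert r ((A j).filter fun s => s.head ≠ r.head))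

theorem mem_selectRule_self (A : Fin n → Finset (Rule n α)) (j : Fin n) (r : Rule n α) :
    r ∈ selectRule A j r j := by
  simp [selectRule]

theorem IsTransversal.selectRule {M : MCS n α} {A : Fin n → Finset (Rule n α)}
    (hA : IsTransversal M A) {j : Fin n} {r : Rule n α} (hr : r ∈ M.br j) :
    IsTransversal M (selectRule A j r) := by
  intro k
  obtain rfl | hk := eq_or_ne k j
  · obtain ⟨hsub, hcov, hinj⟩ := hA k
    simp only [_root_.selectRule, Function.update_self]
    refine ⟨?_, fun p hp => ?_, ?_⟩
    · exact Finset.insert_subset hr ((Finset.filter_subset _ _).trans hsub)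
    · obtain ⟨s, hs, rfl⟩ := hcov p hp
      by_cases h : s.head = r.head
      · exact ⟨r, by simp, h.symm⟩
      · exact ⟨s, by simp [hs, h], rfl⟩
    · intro s hs t ht hst
      simp only [Finset.coe_insert, Finset.coe_filter, Set.mem_insert_iff,
        Set.mem_ofPred_eq] at hs ht
      rcases hs with rfl | ⟨hs, hsr⟩ <;> rcases ht with rfl | ⟨ht, htr⟩
      · rfl
      · exact absurd hst.symm htr
      · exact absurd hst hsr
      · exact hinj hs ht hst
  · simpa [_root_.selectRule, hk] using hA k

omit [DecidableEq α] in
/-- Changing the rules at `j` does not affect whether `j` is reached. -/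
theorem Reaches.congr_off {A B : Fin n → Finset (Rule n α)} {i j : Fin n}
    (h : Reaches A i j) (hAB : ∀ k ≠ j, B k = A k) : Reaches B i j := by
  have key {k : Fin n} (hk : Reaches A i k) : Reaches B i k ∨ Reaches B i j := by
    induction hk with
    | refl => exact Or.inl .refl
    | @tail k l _ hkl ih =>
      rcases ih with ih | ih
      · obtain rfl | hne := eq_or_ne k j
        · exact Or.inr ih
        · exact Or.inl (ih.tail (by simpa [Mentions, hAB k hne] using hkl))
      · exact Or.inr ih
  exact (key h).elim id id

theorem Reaches.selectRule {A : Fin n → Finset (Rule n α)} {i j : Fin n}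
    (h : Reaches A i j) (r : Rule n α) : Reaches (selectRule A j r) i j :=
  h.congr_off fun k hk => by simp [_root_.selectRule, hk]

theorem exists_isTransversal_reaches {M : MCS n α} {i j : Fin n} (h : Reaches M.br i j) :
    ∃ A, IsTransversal M A ∧ Reaches A i j := by
  induction h with
  | refl =>
    obtain ⟨A, hA⟩ := exists_isTransversal M
    exact ⟨A, hA, .refl⟩
  | tail _ hkl ih =>
    obtain ⟨A, hA, hreach⟩ := ih
    obtain ⟨r, hr, hbody⟩ := hkl
    exact ⟨_, hA.selectRule hr,
      (hreach.selectRule r).tail ⟨r, mem_selectRule_self _ _ _, hbody⟩⟩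

open Classical in
/-- The rules of `A` at the contexts reached from `i`. -/
noncomputable def restrictReached (A : Fin n → Finset (Rule n α)) (i j : Fin n) :
    Finset (Rule n α) :=
  if Reaches A i j then A j else ∅

omit [DecidableEq α] in
theorem mem_restrictReached {A : Fin n → Finset (Rule n α)} {i j : Fin n} {r : Rule n α} :
    r ∈ restrictReached A i j ↔ Reaches A i j ∧ r ∈ A j := by
  unfold restrictReached
  split <;> simp_all

theorem SupportPre.covers {M : MCS n α} {b : Fin n → Finset (Rule n α)} {i : Fin n}
    (h : SupportPre M b i) {p : α} (hp : p ∈ sig M i) : ∃ r ∈ b i, r.head = p := by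
  obtain ⟨F, hF, hall⟩ := h
  obtain ⟨-, ⟨In, hIn, hsub⟩, -⟩ := hall _ hF
  obtain ⟨r, hr, hrp⟩ := hIn.2 p hp
  exact ⟨r, hsub hr, hrp⟩

theorem SupportPre.covers_of_mentions {M : MCS n α} {b : Fin n → Finset (Rule n α)}
    {i j k : Fin n} (h : SupportPre M b i) (hjk : Mentions b j k) {p : α}
    (hp : p ∈ sig M k) : ∃ r ∈ b k, r.head = p := by
  obtain ⟨F, hF, hall⟩ := h
  obtain ⟨r, hr, cp, hcp, rfl⟩ := hjk
  obtain ⟨b', hb', hbF⟩ := (hall _ hF).2.2 j r hr cp hcp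
  obtain ⟨s, hs, hsp⟩ := SupportPre.covers ⟨F, hbF, hall⟩ hp
  exact ⟨s, hb' _ hs, hsp⟩

theorem IsTransversal.isSupport_restrictReached {M : MCS n α} {A : Fin n → Finset (Rule n α)}
    (hA : IsTransversal M A) (i : Fin n) : IsSupport M (restrictReached A i) i := by
  constructor
  · refine ⟨{q | q.1 = restrictReached A i ∧ Reaches A i q.2}, ⟨rfl, .refl⟩, ?_⟩
    rintro ⟨_, k⟩ ⟨rfl, hk⟩
    refine ⟨fun j r hr => (hA j).1 (mem_restrictReached.1 hr).2,
      ⟨A k, ⟨(hA k).1, (hA k).2.1⟩, fun r hr => mem_restrictReached.2 ⟨hk, hr⟩⟩, ?_⟩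
    intro j r hr cp hcp
    obtain ⟨hj, hr⟩ := mem_restrictReached.1 hr
    exact ⟨_, fun _ => subset_rfl, rfl, hj.tail ⟨r, hr, cp, hcp, rfl⟩⟩
  · intro b hb hne hpre
    have hfull {k : Fin n} (hcov : ∀ p ∈ sig M k, ∃ r ∈ b k, r.head = p) : A k ⊆ b k := by
      intro r hr
      obtain ⟨s, hs, hsr⟩ := hcov r.head (Finset.mem_image_of_mem _ ((hA k).1 hr))
      rwa [← (hA k).2.2 (mem_restrictReached.1 (hb k hs)).2 hr hsr]
    have hreach {k : Fin n} (hk : Reaches A i k) : A k ⊆ b k := by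
      induction hk with
      | refl => exact hfull fun p hp => hpre.covers hp
      | tail _ hkl ih =>
        obtain ⟨r, hr, hbody⟩ := hkl
        exact hfull fun p hp => hpre.covers_of_mentions ⟨r, ih hr, hbody⟩ hp
    refine hne (funext fun k => (hb k).antisymm fun r hr => ?_)
    obtain ⟨hk, hr⟩ := mem_restrictReached.1 hr
    exact hreach hk hr

/-- Every rule of a context reachable from `i` occurs in some support of `i`. -/
theorem exists_isSupport_mem {M : MCS n α} {i j : Fin n} (h : Reaches M.br i j)
    {r : Rule n α} (hr : r ∈ M.br j) : ∃ b, IsSupport M b i ∧ r ∈ b j := by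
  obtain ⟨A, hA, hreach⟩ := exists_isTransversal_reaches h
  exact ⟨_, (hA.selectRule hr).isSupport_restrictReached i,
    mem_restrictReached.2 ⟨hreach.selectRule r, mem_selectRule_self _ _ _⟩⟩

theorem IsGrounded.le_of_fragment {M M' : MCS n α} (hfrag : Fragment M' M)
    {S S' : Fin n → Finset α} (hS : IsEquilibrium M S) (hS' : IsGrounded M' S') : S' ≤ S := by
  refine hS'.le_of_consequence_le fun j => ?_
  rw [hS j, consequence, hfrag.1]
  refine M.mono j fun p hp => ?_
  obtain ⟨r, hr, hs, rfl⟩ := mem_kbOf.1 hp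
  exact mem_kbOf.2 ⟨r, hfrag.2 j hr, hs, rfl⟩

open Classical in
theorem IsGrounded.subset_of_reaches {M M' : MCS n α} (hfrag : Fragment M' M) {i : Fin n}
    (hbr : ∀ j, Reaches M.br i j → M.br j ⊆ M'.br j)
    {S S' : Fin n → Finset α} (hS : IsGrounded M S) (hS' : IsEquilibrium M' S') {j : Fin n}
    (hj : Reaches M.br i j) : S j ⊆ S' j := by
  let X : Fin n → Finset α := fun k => if Reaches M.br i k then S' k else M.ACC k (sig M k)
  have hX : consequence M X ≤ X := by
    intro k
    by_cases hk : Reaches M.br i k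
    · simp only [X, if_pos hk]
      rw [hS' k, hfrag.1]
      refine M.mono k fun p hp => ?_
      obtain ⟨r, hr, hs, rfl⟩ := mem_kbOf.1 hp
      refine mem_kbOf.2 ⟨r, hbr k hk hr, hs.mono fun cp hcp => ?_, rfl⟩
      have hcp : Reaches M.br i cp.1 := hk.tail ⟨r, hr, cp, hcp, rfl⟩
      simp [hcp]
    · simp only [X, if_neg hk]
      exact M.mono k (Finset.image_subset_image (Finset.filter_subset _ _))
  simpa [X, hj] using hS.le_of_consequence_le hX j

/-- let `M_U` be the fragment of `M` whose bridge rules form the union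
of the bridge-rule sets of all supports of context `i`, with grounded equilibrium
`S_U`. Then for every query literal `p`, `p ∈ S i ↔ p ∈ S_U i`; in particular
`S_U i = S i`, where `S` is the grounded equilibrium of `M`. -/
theorem reasoning_via_union_of_supports (M M_U : MCS n α) (i : Fin n)
    (hfrag : Fragment M_U M)
    (hU : ∀ (j : Fin n) (r : Rule n α),
        r ∈ M_U.br j ↔ ∃ br' : Fin n → Finset (Rule n α), IsSupport M br' i ∧ r ∈ br' j)
    (S S_U : Fin n → Finset α)
    (hS : IsGrounded M S) (hSU : IsGrounded M_U S_U) :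
    (∀ p : α, p ∈ S i ↔ p ∈ S_U i) ∧ S_U i = S i := by
  have h : S_U i = S i :=
    (hSU.le_of_fragment hfrag hS.1 i).antisymm <|
      hS.subset_of_reaches hfrag
        (fun j hj r hr => (hU j r).2 (exists_isSupport_mem hj hr)) hSU.1 .refl
  exact ⟨fun p => by rw [h], h⟩
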